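/- Let d ≥ 1 be an integer and let 0 < λ ≤ Λ and L > 0 be reals. There exist constants Ĉ > 0 and δ₀ > 0, depending only on d, λ, Λ, L, with the following property. Let g : ℝ^d → (symmetric d×d real matrices) satisfy λ|v|² ≤ ⟨g(z)v, v⟩ ≤ Λ|v|² for all z, v ∈ ℝ^d and ‖g(z) − g(z')‖ ≤ L|z − z'| for all z, z' ∈ ℝ^d, and let d_g(x,y) := inf { ∫₀¹ √⟨g(σ(t)) σ'(t), σ'(t)⟩ dt : σ : [0,1] → ℝ^d piecewise C¹, σ(0)=x, σ(1)=y } be the induced length distance. Then for every δ ∈ (0, δ₀), every p ∈ ℝ^d and all x, a ∈ ℝ^d with |x − p| ≤ δ and |a − p| ≤ δ, setting A := g(p), one has (1 − Ĉδ)⟨A(x−a), x−a⟩ ≤ d_g(x,a)² ≤ (1 + Ĉδ)⟨A(x−a), x−a⟩. -/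

import Mathlib

open MeasureTheory ENNReal Filter Topology RealInnerProductSpace

/-- The length distance induced by a positive definite matrix (linear-map) field `g` on `ℝ^d`:
the infimum of Riemannian lengths `∫₀¹ √⟨g(σ(t)) σ'(t), σ'(t)⟩ dt` over `C¹` curves joining
the two points. -/
noncomputable def riemLengthDist (d : ℕ)
    (g : EuclideanSpace ℝ (Fin d) → (EuclideanSpace ℝ (Fin d) →L[ℝ] EuclideanSpace ℝ (Fin d)))
    (x y : EuclideanSpace ℝ (Fin d)) : ℝ :=
  sInf { l : ℝ | ∃ σ : ℝ → EuclideanSpace ℝ (Fin d), σ 0 = x ∧ σ 1 = y ∧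
    ContDiffOn ℝ 1 σ (Set.Icc 0 1) ∧
    l = ∫ t in (0 : ℝ)..1,
      Real.sqrt ⟪g (σ t) (derivWithin σ (Set.Icc 0 1) t), derivWithin σ (Set.Icc 0 1) t⟫ }

section Curves

variable {E : Type*} [NormedAddCommGroup E] [InnerProductSpace ℝ E]

/-- If a continuous nonnegative integrand dominates `⟪σ', u⟫` along a `C¹` curve, its integral
dominates the displacement of the curve in the direction `u` at any time. -/
lemma inner_sub_le_integral_of_inner_derivWithin_le {σ : ℝ → E} {f : ℝ → ℝ} {u : E} {t : ℝ}
    (hσ : ContDiffOn ℝ 1 σ (Set.Icc 0 1)) (hf : ContinuousOn f (Set.Icc 0 1))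
    (hf0 : ∀ s, 0 ≤ f s) (ht : t ∈ Set.Icc (0 : ℝ) 1)
    (hu : ∀ s ∈ Set.Icc (0 : ℝ) 1, ⟪derivWithin σ (Set.Icc 0 1) s, u⟫ ≤ f s) :
    ⟪σ t - σ 0, u⟫ ≤ ∫ s in (0 : ℝ)..1, f s := by
  have hsub : Set.Icc 0 t ⊆ Set.Icc (0 : ℝ) 1 := Set.Icc_subset_Icc_right ht.2
  have hd : ContinuousOn (fun s => ⟪derivWithin σ (Set.Icc 0 1) s, u⟫) (Set.Icc 0 1) :=
    (hσ.continuousOn_derivWithin (uniqueDiffOn_Icc zero_lt_one) le_rfl).inner continuousOn_const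
  have hint : IntervalIntegrable f volume 0 1 :=
    hf.intervalIntegrable_of_Icc zero_le_one
  have hint_t : IntervalIntegrable f volume 0 t :=
    (hf.mono hsub).intervalIntegrable_of_Icc ht.1
  have hdint : IntervalIntegrable (fun s => ⟪derivWithin σ (Set.Icc 0 1) s, u⟫) volume 0 t :=
    (hd.mono hsub).intervalIntegrable_of_Icc ht.1
  have hftc : ∫ s in (0 : ℝ)..t, ⟪derivWithin σ (Set.Icc 0 1) s, u⟫ = ⟪σ t, u⟫ - ⟪σ 0, u⟫ := by
    refine intervalIntegral.integral_eq_sub_of_hasDerivAt_of_le ht.1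
      (f := fun s => ⟪σ s, u⟫)
      ((hσ.continuousOn.mono hsub).inner continuousOn_const) (fun s hs => ?_) hdint
    have hs1 : s ∈ Set.Icc (0 : ℝ) 1 := hsub (Set.Ioo_subset_Icc_self hs)
    have hder : HasDerivAt σ (derivWithin σ (Set.Icc 0 1) s) s :=
      ((hσ.differentiableOn one_ne_zero s hs1).hasDerivWithinAt).hasDerivAt
        (Icc_mem_nhds hs.1 (hs.2.trans_le ht.2))
    simpa using hder.inner ℝ (hasDerivAt_const s u)
  calc ⟪σ t - σ 0, u⟫ = ∫ s in (0 : ℝ)..t, ⟪derivWithin σ (Set.Icc 0 1) s, u⟫ := by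
        rw [hftc, inner_sub_left]
    _ ≤ ∫ s in (0 : ℝ)..t, f s :=
        intervalIntegral.integral_mono_on ht.1 hdint hint_t fun s hs => hu s (hsub hs)
    _ ≤ ∫ s in (0 : ℝ)..1, f s :=
        intervalIntegral.integral_mono_interval le_rfl ht.1 ht.2
          (Eventually.of_forall hf0) hint

/-- Cauchy–Schwarz inequality for a symmetric positive semidefinite operator. -/
lemma inner_map_sq_le_of_symmetric {A : E →L[ℝ] E} (hsymm : ∀ v w, ⟪A v, w⟫ = ⟪v, A w⟫)
    (hpos : ∀ v, 0 ≤ ⟪A v, v⟫) (v : E) {w : E} (hw : 0 < ⟪A w, w⟫) :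
    ⟪A v, w⟫ ^ 2 ≤ ⟪A v, v⟫ * ⟪A w, w⟫ := by
  have h := hpos (⟪A w, w⟫ • v - ⟪A v, w⟫ • w)
  have hwv : ⟪A w, v⟫ = ⟪A v, w⟫ := by rw [hsymm, real_inner_comm]
  simp only [map_sub, map_smul, inner_sub_left, inner_sub_right, real_inner_smul_left,
    real_inner_smul_right, hwv] at h
  have h' : 0 ≤ ⟪A w, w⟫ * (⟪A v, v⟫ * ⟪A w, w⟫ - ⟪A v, w⟫ ^ 2) := by linarith
  linarith [nonneg_of_mul_nonneg_right h' hw]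

lemma abs_inner_map_sub_inner_map_le (A B : E →L[ℝ] E) (v : E) :
    |⟪A v, v⟫ - ⟪B v, v⟫| ≤ ‖A - B‖ * ‖v‖ ^ 2 := by
  rw [← inner_sub_left, ← sub_apply]
  calc |⟪(A - B) v, v⟫| ≤ ‖(A - B) v‖ * ‖v‖ := abs_real_inner_le_norm _ _
    _ ≤ ‖A - B‖ * ‖v‖ * ‖v‖ := by gcongr; exact (A - B).le_opNorm v
    _ = ‖A - B‖ * ‖v‖ ^ 2 := by ring

/-- Two operators at distance at most `r` have comparable quadratic forms, relative to a lower
bound `lam` for one of them. -/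
lemma abs_inner_map_sub_inner_map_le_mul {A B : E →L[ℝ] E} {lam r : ℝ} (hlam : 0 < lam)
    (hr : ‖B - A‖ ≤ r) (hA : ∀ v, lam * ‖v‖ ^ 2 ≤ ⟪A v, v⟫) (v : E) :
    |⟪B v, v⟫ - ⟪A v, v⟫| ≤ r / lam * ⟪A v, v⟫ := by
  have hr0 : 0 ≤ r := (norm_nonneg _).trans hr
  calc |⟪B v, v⟫ - ⟪A v, v⟫| ≤ ‖B - A‖ * ‖v‖ ^ 2 := abs_inner_map_sub_inner_map_le B A v
    _ ≤ r * ‖v‖ ^ 2 := by gcongr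
    _ = r / lam * (lam * ‖v‖ ^ 2) := by field_simp
    _ ≤ r / lam * ⟪A v, v⟫ := by gcongr; exact hA v

/-- Lower bound for the length of a curve along which the metric dominates `m` times a constant
metric `A`. -/
lemma sqrt_mul_inner_map_le_length {g : E → E →L[ℝ] E} {σ : ℝ → E} {A : E →L[ℝ] E} {m : ℝ}
    (hm : 0 ≤ m) (hg : Continuous g) (hσ : ContDiffOn ℝ 1 σ (Set.Icc 0 1))
    (hsymm : ∀ v w, ⟪A v, w⟫ = ⟪v, A w⟫) (hpos : ∀ v, 0 ≤ ⟪A v, v⟫)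
    {t : ℝ} (ht : t ∈ Set.Icc (0 : ℝ) 1)
    (hmA : ∀ s ∈ Set.Icc (0 : ℝ) 1, ∀ v, m * ⟪A v, v⟫ ≤ ⟪g (σ s) v, v⟫) :
    Real.sqrt (m * ⟪A (σ t - σ 0), σ t - σ 0⟫) ≤ ∫ s in (0 : ℝ)..1,
      Real.sqrt ⟪g (σ s) (derivWithin σ (Set.Icc 0 1) s), derivWithin σ (Set.Icc 0 1) s⟫ := by
  set w := σ t - σ 0 with hw
  have hd : ContinuousOn (derivWithin σ (Set.Icc 0 1)) (Set.Icc 0 1) :=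
    hσ.continuousOn_derivWithin (uniqueDiffOn_Icc zero_lt_one) le_rfl
  have hf : ContinuousOn (fun s => Real.sqrt
      ⟪g (σ s) (derivWithin σ (Set.Icc 0 1) s), derivWithin σ (Set.Icc 0 1) s⟫)
      (Set.Icc 0 1) :=
    (((hg.comp_continuousOn hσ.continuousOn).clm_apply hd).inner hd).sqrt
  rcases (hpos w).eq_or_lt with h0 | h0
  · rw [← h0, mul_zero, Real.sqrt_zero]
    exact intervalIntegral.integral_nonneg zero_le_one fun s _ => Real.sqrt_nonneg _
  have key := inner_sub_le_integral_of_inner_derivWithin_le hσ hf (fun s => Real.sqrt_nonneg _) ht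
    (u := (Real.sqrt m / Real.sqrt ⟪A w, w⟫) • A w) (fun s hs => ?_)
  · refine le_trans (le_of_eq ?_) key
    rw [← hw, real_inner_smul_right, ← hsymm, Real.sqrt_mul hm, div_mul_eq_mul_div, mul_div_assoc,
      Real.div_sqrt]
  · set v := derivWithin σ (Set.Icc 0 1) s
    rw [real_inner_smul_right, ← hsymm]
    refine Real.le_sqrt_of_sq_le (le_trans ?_ (hmA s hs v))
    rw [mul_pow, div_pow, Real.sq_sqrt hm, Real.sq_sqrt h0.le, div_mul_eq_mul_div, mul_div_assoc]
    gcongr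
    rw [div_le_iff₀ h0]
    exact inner_map_sq_le_of_symmetric hsymm hpos v h0

end Curves

section LengthDistance

variable {d : ℕ} {g : EuclideanSpace ℝ (Fin d) → (EuclideanSpace ℝ (Fin d) →L[ℝ]
  EuclideanSpace ℝ (Fin d))} {x y : EuclideanSpace ℝ (Fin d)}

lemma derivWithin_segment (x y : EuclideanSpace ℝ (Fin d)) {t : ℝ} (ht : t ∈ Set.Icc (0 : ℝ) 1) :
    derivWithin (fun s : ℝ => x + s • (y - x)) (Set.Icc 0 1) t = y - x := by
  have h : HasDerivAt (fun s : ℝ => x + s • (y - x)) (y - x) t := by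
    simpa using ((hasDerivAt_id t).smul_const (y - x)).const_add x
  exact h.hasDerivWithinAt.derivWithin (uniqueDiffOn_Icc zero_lt_one t ht)

/-- The length of the segment from `x` to `y` belongs to the set of lengths whose infimum is the
length distance. -/
lemma segment_length_mem (x y : EuclideanSpace ℝ (Fin d)) :
    (∫ t in (0 : ℝ)..1, Real.sqrt ⟪g (x + t • (y - x)) (y - x), y - x⟫) ∈
      { l : ℝ | ∃ σ : ℝ → EuclideanSpace ℝ (Fin d), σ 0 = x ∧ σ 1 = y ∧
        ContDiffOn ℝ 1 σ (Set.Icc 0 1) ∧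
        l = ∫ t in (0 : ℝ)..1,
          Real.sqrt ⟪g (σ t) (derivWithin σ (Set.Icc 0 1) t),
            derivWithin σ (Set.Icc 0 1) t⟫ } := by
  refine ⟨fun t => x + t • (y - x), by simp, by simp, by fun_prop, ?_⟩
  refine intervalIntegral.integral_congr fun t ht => ?_
  rw [Set.uIcc_of_le zero_le_one] at ht
  simp only [derivWithin_segment x y ht]

lemma riemLengthDist_nonneg : 0 ≤ riemLengthDist d g x y := by
  refine Real.sInf_nonneg ?_
  rintro l ⟨σ, -, -, -, rfl⟩
  exact intervalIntegral.integral_nonneg zero_le_one fun s _ => Real.sqrt_nonneg _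

lemma riemLengthDist_le_of_segment {M : ℝ}
    (hM : ∀ t ∈ Set.Icc (0 : ℝ) 1, ⟪g (x + t • (y - x)) (y - x), y - x⟫ ≤ M) :
    riemLengthDist d g x y ≤ Real.sqrt M := by
  refine (csInf_le ⟨0, ?_⟩ (segment_length_mem x y)).trans ?_
  · rintro l ⟨σ, -, -, -, rfl⟩
    exact intervalIntegral.integral_nonneg zero_le_one fun s _ => Real.sqrt_nonneg _
  · have h := intervalIntegral.norm_integral_le_of_norm_le_const (a := (0 : ℝ)) (b := 1)
      (f := fun t => Real.sqrt ⟪g (x + t • (y - x)) (y - x), y - x⟫) (C := Real.sqrt M)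
      (fun t ht => by
        rw [Set.uIoc_of_le zero_le_one] at ht
        rw [Real.norm_of_nonneg (Real.sqrt_nonneg _)]
        exact Real.sqrt_le_sqrt (hM t (Set.Ioc_subset_Icc_self ht)))
    simpa using (le_abs_self _).trans h

lemma le_riemLengthDist {m : ℝ}
    (hm : ∀ σ : ℝ → EuclideanSpace ℝ (Fin d), σ 0 = x → σ 1 = y →
      ContDiffOn ℝ 1 σ (Set.Icc 0 1) → m ≤ ∫ t in (0 : ℝ)..1,
        Real.sqrt ⟪g (σ t) (derivWithin σ (Set.Icc 0 1) t), derivWithin σ (Set.Icc 0 1) t⟫) :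
    m ≤ riemLengthDist d g x y := by
  refine le_csInf ⟨_, segment_length_mem x y⟩ ?_
  rintro l ⟨σ, h0, h1, hσ, rfl⟩
  exact hm σ h0 h1 hσ

end LengthDistance

theorem metric_approximation_by_constant (d : ℕ) (hd : 1 ≤ d)
    (lam Lam L : ℝ) (hlam : 0 < lam) (hlamLam : lam ≤ Lam) (hL : 0 < L) :
    ∃ Chat δ₀ : ℝ, 0 < Chat ∧ 0 < δ₀ ∧
      ∀ g : EuclideanSpace ℝ (Fin d) →
          (EuclideanSpace ℝ (Fin d) →L[ℝ] EuclideanSpace ℝ (Fin d)),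
        (∀ z v w, ⟪g z v, w⟫ = ⟪v, g z w⟫) →
        (∀ z v, lam * ‖v‖ ^ 2 ≤ ⟪g z v, v⟫ ∧ ⟪g z v, v⟫ ≤ Lam * ‖v‖ ^ 2) →
        (∀ z z', ‖g z - g z'‖ ≤ L * ‖z - z'‖) →
        ∀ δ : ℝ, 0 < δ → δ < δ₀ →
          ∀ p x a : EuclideanSpace ℝ (Fin d), ‖x - p‖ ≤ δ → ‖a - p‖ ≤ δ →
            (1 - Chat * δ) * ⟪g p (x - a), x - a⟫ ≤ riemLengthDist d g x a ^ 2 ∧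
            riemLengthDist d g x a ^ 2 ≤ (1 + Chat * δ) * ⟪g p (x - a), x - a⟫ := by
  have hLam : 0 < Lam := hlam.trans_le hlamLam
  obtain ⟨R, hR⟩ : ∃ R, R = 1 + 2 * (Lam / lam) := ⟨_, rfl⟩
  have hratio : 1 ≤ Lam / lam := (one_le_div hlam).2 hlamLam
  have hR1 : 1 ≤ R := by linarith
  have hC : 0 < L * R / lam := by positivity
  refine ⟨L * R / lam, (L * R / lam)⁻¹, hC, inv_pos.2 hC, ?_⟩
  intro g hsymm hell hlip δ hδ hδ₀ p x a hx ha
  have hCδ : L * R / lam * δ < 1 := by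
    rw [← mul_inv_cancel₀ hC.ne']; gcongr
  have hg : Continuous g := by
    refine (LipschitzWith.of_dist_le_mul (K := ⟨L, hL.le⟩) fun z z' => ?_).continuous
    rw [dist_eq_norm, dist_eq_norm]
    exact hlip z z'
  have hpos : ∀ z v, 0 ≤ ⟪g z v, v⟫ := fun z v => le_trans (by positivity) (hell z v).1
  have hclose : ∀ z, ‖z - p‖ ≤ R * δ → ∀ v,
      |⟪g z v, v⟫ - ⟪g p v, v⟫| ≤ L * R / lam * δ * ⟪g p v, v⟫ := by
    intro z hz v
    have := abs_inner_map_sub_inner_map_le_mul hlam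
      ((hlip z p).trans (mul_le_mul_of_nonneg_left hz hL.le)) (fun v => (hell p v).1) v
    convert this using 2
    ring
  have hneg : ⟪g p (a - x), a - x⟫ = ⟪g p (x - a), x - a⟫ := by
    rw [← neg_sub x a, map_neg, inner_neg_neg]
  constructor
  · refine (Real.sqrt_le_left riemLengthDist_nonneg).1 (le_riemLengthDist ?_)
    intro σ h0 h1 hσ
    by_cases hstay : ∀ s ∈ Set.Icc (0 : ℝ) 1, ‖σ s - p‖ ≤ R * δ
    · have := sqrt_mul_inner_map_le_length (t := 1) (A := g p) (sub_nonneg.2 hCδ.le) hg hσ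
        (hsymm p) (hpos p) (by simp) fun s hs v => by
          linarith [(abs_le.1 (hclose _ (hstay s hs) v)).1]
      rwa [h0, h1, hneg] at this
    · push Not at hstay
      obtain ⟨t, ht, hfar⟩ := hstay
      have := sqrt_mul_inner_map_le_length (t := t) (A := ContinuousLinearMap.id ℝ _) hlam.le hg hσ
        (by simp) (fun v => real_inner_self_nonneg) ht fun s hs v => by
          simpa [real_inner_self_eq_norm_sq] using (hell (σ s) v).1
      refine le_trans (Real.sqrt_le_sqrt ?_) this
      simp only [ContinuousLinearMap.id_apply, real_inner_self_eq_norm_sq, h0]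
      have hdist : 2 * (Lam / lam) * δ ≤ ‖σ t - x‖ := by
        have := norm_sub_le_norm_sub_add_norm_sub (σ t) x p
        rw [hR] at hfar
        linarith
      have hxa : ‖x - a‖ ≤ 2 * δ := by
        have := norm_sub_le_norm_sub_add_norm_sub x p a
        rw [norm_sub_rev p a] at this
        linarith
      calc (1 - L * R / lam * δ) * ⟪g p (x - a), x - a⟫
          ≤ 1 * ⟪g p (x - a), x - a⟫ := by
            gcongr
            · exact hpos p _
            · linarith [mul_pos hC hδ]
        _ ≤ Lam * ‖x - a‖ ^ 2 := by rw [one_mul]; exact (hell p _).2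
        _ ≤ Lam * (2 * δ) ^ 2 := by gcongr
        _ = lam * ((Lam / lam) * 1 * (2 * δ) ^ 2) := by field_simp
        _ ≤ lam * ((Lam / lam) * (Lam / lam) * (2 * δ) ^ 2) := by gcongr
        _ = lam * (2 * (Lam / lam) * δ) ^ 2 := by ring
        _ ≤ lam * ‖σ t - x‖ ^ 2 := by gcongr
  · have hM : 0 ≤ (1 + L * R / lam * δ) * ⟪g p (x - a), x - a⟫ :=
      mul_nonneg (by positivity) (hpos p _)
    refine (Real.le_sqrt riemLengthDist_nonneg hM).1 (riemLengthDist_le_of_segment fun t ht => ?_)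
    have hz : ‖x + t • (a - x) - p‖ ≤ R * δ := by
      have hball := (convex_closedBall p δ).add_smul_sub_mem
        (mem_closedBall_iff_norm.2 hx) (mem_closedBall_iff_norm.2 ha) ht
      exact (mem_closedBall_iff_norm.1 hball).trans (le_mul_of_one_le_left hδ.le hR1)
    have := (abs_le.1 (hclose _ hz (a - x))).2
    rw [hneg] at this
    linarith
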